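/- The number of (n,b)-domino towers equals the binomial coefficient C(2n-1, n-b) for all n ≥ b ≥ 1. -/

import Mathlib

/-- The dominoes of `D` at level `y`, identified by the x-coordinate of their left cell. -/
def rowSet (D : Finset (ℤ × ℕ)) (y : ℕ) : Finset ℤ :=
  (D.filter (fun p => p.2 = y)).image Prod.fst

/-- Dominoes at the same level do not overlap. -/
def NoOverlap (D : Finset (ℤ × ℕ)) : Prop :=
  ∀ p ∈ D, (p.1 + 1, p.2) ∉ D

/-- Every domino above the base is supported by a domino one level below,
at horizontal offset `-1`, `0`, or `+1`. -/
def Supported (D : Finset (ℤ × ℕ)) : Prop :=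
  ∀ (x : ℤ) (y : ℕ), (x, y + 1) ∈ D →
    (x - 1, y) ∈ D ∨ (x, y) ∈ D ∨ (x + 1, y) ∈ D

/-- `D` is an `(n,b)`-domino tower: `n` dominoes in total, the level-0 dominoes form a
contiguous horizontal base of `b` dominoes (normalized to start at `x = 0`),
no two dominoes overlap, and every non-base domino is supported. -/
def IsDominoTower (n b : ℕ) (D : Finset (ℤ × ℕ)) : Prop :=
  D.card = n ∧
  rowSet D 0 = (Finset.range b).image (fun t : ℕ => 2 * (t : ℤ)) ∧
  NoOverlap D ∧ Supported D

open Finset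

/-- The positions overlapping some domino of `T`, i.e. those supported by `T` from below. -/
def neighbors (T : Finset ℤ) : Finset ℤ :=
  T.biUnion fun x => {x - 1, x, x + 1}

/-- The subsets of `A` consisting of pairwise non-overlapping dominoes. -/
def disjointRows (A : Finset ℤ) : Finset (Finset ℤ) :=
  A.powerset.filter fun T => ∀ x ∈ T, x + 1 ∉ T

/-- The towers with `n` dominoes whose bottom row is exactly `T`. -/
def towersOn (T : Finset ℤ) (n : ℤ) : Set (Finset (ℤ × ℕ)) :=
  {D | (D.card : ℤ) = n ∧ rowSet D 0 = T ∧ NoOverlap D ∧ Supported D}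

/-- The towers with `n` dominoes whose bottom row is contained in `A`. -/
def towersWithin (A : Finset ℤ) (n : ℤ) : Set (Finset (ℤ × ℕ)) :=
  {D | (D.card : ℤ) = n ∧ rowSet D 0 ⊆ A ∧ NoOverlap D ∧ Supported D}

/-- Raise `D` by one level and insert `T` as the new bottom row. -/
def stack (T : Finset ℤ) (D : Finset (ℤ × ℕ)) : Finset (ℤ × ℕ) :=
  T.image (fun x => (x, 0)) ∪ D.image (fun p => (p.1, p.2 + 1))

theorem mem_rowSet {D : Finset (ℤ × ℕ)} {x : ℤ} {y : ℕ} : x ∈ rowSet D y ↔ (x, y) ∈ D := by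
  simp [rowSet]

theorem mem_neighbors {T : Finset ℤ} {x : ℤ} :
    x ∈ neighbors T ↔ x - 1 ∈ T ∨ x ∈ T ∨ x + 1 ∈ T := by
  simp only [neighbors, mem_biUnion, mem_insert, mem_singleton]
  constructor
  · rintro ⟨a, ha, rfl | rfl | rfl⟩ <;> simp [ha]
  · rintro (h | h | h)
    · exact ⟨_, h, by simp⟩
    · exact ⟨_, h, by simp⟩
    · exact ⟨_, h, by simp⟩

theorem neighbors_union (S T : Finset ℤ) : neighbors (S ∪ T) = neighbors S ∪ neighbors T := by
  ext x
  simp only [mem_neighbors, mem_union]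
  tauto

theorem mem_disjointRows {A T : Finset ℤ} :
    T ∈ disjointRows A ↔ T ⊆ A ∧ ∀ x ∈ T, x + 1 ∉ T := by
  simp [disjointRows]

theorem mem_stack_zero {T : Finset ℤ} {D : Finset (ℤ × ℕ)} {x : ℤ} :
    (x, 0) ∈ stack T D ↔ x ∈ T := by
  simp [stack]

theorem mem_stack_succ {T : Finset ℤ} {D : Finset (ℤ × ℕ)} {x : ℤ} {y : ℕ} :
    (x, y + 1) ∈ stack T D ↔ (x, y) ∈ D := by
  simp [stack]

theorem rowSet_stack_zero (T : Finset ℤ) (D : Finset (ℤ × ℕ)) : rowSet (stack T D) 0 = T := by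
  ext x
  rw [mem_rowSet, mem_stack_zero]

theorem stack_injective (T : Finset ℤ) : Function.Injective (stack T) := by
  intro D E h
  ext ⟨x, y⟩
  rw [← mem_stack_succ (T := T), h, mem_stack_succ]

theorem card_stack (T : Finset ℤ) (D : Finset (ℤ × ℕ)) :
    (stack T D).card = T.card + D.card := by
  rw [stack, card_union_of_disjoint, card_image_of_injective, card_image_of_injective]
  · rintro ⟨a, b⟩ ⟨c, d⟩ h
    simpa using h
  · intro a b h
    simpa using h
  · rw [disjoint_left]
    rintro ⟨x, y⟩ h h'
    simp only [mem_image, Prod.mk.injEq] at h h'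
    obtain ⟨_, _, _, rfl⟩ := h
    obtain ⟨_, _, _, h⟩ := h'
    omega

theorem exists_eq_stack (D : Finset (ℤ × ℕ)) : ∃ E, stack (rowSet D 0) E = D := by
  refine ⟨(D.filter fun p => p.2 ≠ 0).image fun p => (p.1, p.2 - 1), ?_⟩
  ext ⟨x, y⟩
  cases y with
  | zero => rw [mem_stack_zero, mem_rowSet]
  | succ y =>
    rw [mem_stack_succ]
    simp only [mem_image, mem_filter, Prod.mk.injEq, Prod.exists]
    constructor
    · rintro ⟨a, b, ⟨h, hb⟩, rfl, rfl⟩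
      rwa [Nat.sub_add_cancel (Nat.pos_of_ne_zero hb)]
    · exact fun h => ⟨x, y + 1, ⟨h, by omega⟩, rfl, rfl⟩

theorem noOverlap_stack {T : Finset ℤ} {D : Finset (ℤ × ℕ)} :
    NoOverlap (stack T D) ↔ (∀ x ∈ T, x + 1 ∉ T) ∧ NoOverlap D := by
  constructor
  · refine fun h => ⟨fun x hx => ?_, fun ⟨x, y⟩ hp => ?_⟩
    · have := h (x, 0) (mem_stack_zero.2 hx)
      rwa [mem_stack_zero] at this
    · have := h (x, y + 1) (mem_stack_succ.2 hp)
      rwa [mem_stack_succ] at this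
  · rintro ⟨hT, hD⟩ ⟨x, y⟩ hp
    cases y with
    | zero =>
      rw [mem_stack_zero] at hp ⊢
      exact hT x hp
    | succ y =>
      rw [mem_stack_succ] at hp ⊢
      exact hD _ hp

theorem supported_stack {T : Finset ℤ} {D : Finset (ℤ × ℕ)} :
    Supported (stack T D) ↔ rowSet D 0 ⊆ neighbors T ∧ Supported D := by
  constructor
  · refine fun h => ⟨fun x hx => ?_, fun x y hp => ?_⟩
    · have := h x 0 (mem_stack_succ.2 (mem_rowSet.1 hx))
      simpa only [mem_stack_zero, mem_neighbors] using this
    · have := h x (y + 1) (mem_stack_succ.2 hp)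
      simpa only [mem_stack_succ] using this
  · rintro ⟨hT, hD⟩ x y hp
    rw [mem_stack_succ] at hp
    cases y with
    | zero =>
      simp only [mem_stack_zero]
      exact mem_neighbors.1 (hT (mem_rowSet.2 hp))
    | succ y =>
      simp only [mem_stack_succ]
      exact hD x y hp

theorem encard_towersOn {T : Finset ℤ} (hT : ∀ x ∈ T, x + 1 ∉ T) (n : ℤ) :
    (towersOn T n).encard = (towersWithin (neighbors T) (n - T.card)).encard := by
  rw [← (stack_injective T).encard_image (towersWithin _ _)]
  congr 1
  ext D
  constructor
  · rintro ⟨hn, hr, ho, hs⟩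
    obtain ⟨E, hE⟩ := exists_eq_stack D
    rw [hr] at hE
    subst hE
    rw [card_stack] at hn
    exact ⟨E, ⟨by push_cast at hn; omega, (supported_stack.1 hs).1, (noOverlap_stack.1 ho).2,
      (supported_stack.1 hs).2⟩, rfl⟩
  · rintro ⟨E, ⟨hn, hr, ho, hs⟩, rfl⟩
    exact ⟨by rw [card_stack]; push_cast; omega, rowSet_stack_zero T E,
      noOverlap_stack.2 ⟨hT, ho⟩, supported_stack.2 ⟨hr, hs⟩⟩

theorem encard_biUnion_of_pairwiseDisjoint {ι α : Type*} (s : Finset ι) (f : ι → Set α)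
    (h : (s : Set ι).PairwiseDisjoint f) : (⋃ i ∈ s, f i).encard = ∑ i ∈ s, (f i).encard := by
  classical
  induction s using Finset.induction_on with
  | empty => simp
  | insert a s ha ih =>
    rw [coe_insert, Set.pairwiseDisjoint_insert_of_notMem (by simpa using ha)] at h
    rw [set_biUnion_insert, sum_insert ha, Set.encard_union_eq, ih h.1]
    simp only [Set.disjoint_iUnion_right]
    exact h.2

theorem encard_towersWithin (A : Finset ℤ) (n : ℤ) :
    (towersWithin A n).encard =
      ∑ T ∈ disjointRows A, (towersWithin (neighbors T) (n - T.card)).encard := by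
  have h : towersWithin A n = ⋃ T ∈ disjointRows A, towersOn T n := by
    ext D
    simp only [Set.mem_iUnion, exists_prop]
    constructor
    · rintro ⟨hn, hr, ho, hs⟩
      refine ⟨rowSet D 0, mem_disjointRows.2 ⟨hr, fun x hx => ?_⟩, hn, rfl, ho, hs⟩
      rw [mem_rowSet] at hx ⊢
      exact ho _ hx
    · rintro ⟨T, hT, hn, rfl, ho, hs⟩
      exact ⟨hn, (mem_disjointRows.1 hT).1, ho, hs⟩
  rw [h, encard_biUnion_of_pairwiseDisjoint]
  · exact sum_congr rfl fun T hT => encard_towersOn (mem_disjointRows.1 hT).2 n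
  · intro S _ T _ hST
    rw [Function.onFun, Set.disjoint_left]
    rintro D ⟨_, hS, _⟩ ⟨_, hT, _⟩
    exact hST (hS.symm.trans hT)

theorem encard_towersWithin_of_neg (A : Finset ℤ) {n : ℤ} (hn : n < 0) :
    (towersWithin A n).encard = 0 := by
  rw [Set.encard_eq_zero, Set.eq_empty_iff_forall_notMem]
  rintro D ⟨h, _⟩
  omega

theorem encard_towersWithin_zero (A : Finset ℤ) : (towersWithin A 0).encard = 1 := by
  rw [Set.encard_eq_one]
  refine ⟨∅, ?_⟩
  ext D
  rw [Set.mem_singleton_iff]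
  constructor
  · rintro ⟨h, _⟩
    simpa using h
  · rintro rfl
    exact ⟨by simp, by simp [rowSet], by simp [NoOverlap], by simp [Supported]⟩

theorem encard_towersWithin_empty {n : ℤ} (hn : n ≠ 0) : (towersWithin ∅ n).encard = 0 := by
  rw [Set.encard_eq_zero, Set.eq_empty_iff_forall_notMem]
  rintro D ⟨h, hr, _, hs⟩
  have key : ∀ (y : ℕ) (x : ℤ), (x, y) ∉ D := by
    intro y
    induction y with
    | zero => exact fun x hx => notMem_empty x (hr (mem_rowSet.2 hx))
    | succ y ih =>
      intro x hx
      rcases hs x y hx with h | h | h <;> exact ih _ h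
  have : D = ∅ := eq_empty_of_forall_notMem fun p => key p.2 p.1
  subst this
  simp at h
  exact hn h.symm

theorem sum_disjointRows_eq {M : Type*} [AddCommMonoid M] {A W : Finset ℤ} (hW : W ⊆ A)
    (f : Finset ℤ → M) :
    ∑ T ∈ disjointRows A, f T =
      ∑ V ∈ disjointRows W, ∑ U ∈ disjointRows ((A \ W) \ neighbors V), f (V ∪ U) := by
  rw [sum_sigma']
  refine sum_bij' (fun T _ => ⟨T ∩ W, T \ W⟩) (fun p _ => p.1 ∪ p.2) ?_ ?_ ?_ ?_ ?_
  · intro T hT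
    rw [mem_disjointRows] at hT
    simp only [mem_sigma, mem_disjointRows]
    refine ⟨⟨inter_subset_right, fun x hx hx' => hT.2 x (mem_inter.1 hx).1 (mem_inter.1 hx').1⟩,
      fun x hx => ?_, fun x hx hx' => hT.2 x (mem_sdiff.1 hx).1 (mem_sdiff.1 hx').1⟩
    rw [mem_sdiff] at hx
    simp only [mem_sdiff, mem_neighbors, mem_inter]
    refine ⟨⟨hT.1 hx.1, hx.2⟩, ?_⟩
    rintro (h | h | h)
    · exact hT.2 _ h.1 (by simpa using hx.1)
    · exact hx.2 h.2
    · exact hT.2 _ hx.1 h.1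
  · rintro ⟨V, U⟩ h
    simp only [mem_sigma, mem_disjointRows] at h
    obtain ⟨⟨hV, hV'⟩, hU, hU'⟩ := h
    refine mem_disjointRows.2 ⟨union_subset (hV.trans hW)
      (hU.trans (sdiff_subset.trans sdiff_subset)), fun x hx hx' => ?_⟩
    rw [mem_union] at hx hx'
    have hN : ∀ z ∈ U, z ∉ neighbors V := fun z hz => (mem_sdiff.1 (hU hz)).2
    rcases hx with hx | hx <;> rcases hx' with hx' | hx'
    · exact hV' x hx hx'
    · exact hN _ hx' (mem_neighbors.2 (Or.inl (by simpa using hx)))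
    · exact hN _ hx (mem_neighbors.2 (Or.inr (Or.inr hx')))
    · exact hU' x hx hx'
  · intro T _
    rw [union_comm]
    exact sdiff_union_inter T W
  · rintro ⟨V, U⟩ h
    simp only [mem_sigma, mem_disjointRows] at h
    obtain ⟨⟨hV, -⟩, hU, -⟩ := h
    have hUW : ∀ z ∈ U, z ∉ W := fun z hz => (mem_sdiff.1 (mem_sdiff.1 (hU hz)).1).2
    have h₁ : (V ∪ U) ∩ W = V := by
      ext x
      have := @hV x
      have := hUW x
      simp only [mem_inter, mem_union]
      tauto
    have h₂ : (V ∪ U) \ W = U := by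
      ext x
      have := @hV x
      have := hUW x
      simp only [mem_sdiff, mem_union]
      tauto
    simp only [h₁, h₂]
  · intro T _
    dsimp only
    rw [union_comm, sdiff_union_inter]

theorem card_union_of_mem_disjointRows {B V U : Finset ℤ}
    (hU : U ∈ disjointRows (B \ neighbors V)) : (V ∪ U).card = V.card + U.card := by
  refine card_union_of_disjoint (disjoint_left.2 fun x hV hx => ?_)
  exact (mem_sdiff.1 ((mem_disjointRows.1 hU).1 hx)).2 (mem_neighbors.2 (Or.inr (Or.inl hV)))

/-- Sorting the towers by the part of the bottom row lying in `W`: once that part is removed, the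
remaining dominoes fall down to an arbitrary tower over the freed positions. -/
theorem encard_towersWithin_eq_sum (n : ℤ) {A W : Finset ℤ} (hW : W ⊆ A) :
    (towersWithin A n).encard =
      ∑ V ∈ disjointRows W, (towersWithin (A \ W ∪ neighbors V) (n - V.card)).encard := by
  obtain ⟨N, hN⟩ : ∃ N : ℕ, n < N := ⟨n.toNat + 1, by omega⟩
  induction N generalizing n A W with
  | zero =>
    rw [encard_towersWithin_of_neg A (by simpa using hN)]
    exact (sum_eq_zero fun V _ => encard_towersWithin_of_neg _ (by omega)).symm
  | succ N ih =>
    rw [encard_towersWithin A n, sum_disjointRows_eq hW]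
    refine sum_congr rfl fun V _ => ?_
    rw [encard_towersWithin (A \ W ∪ neighbors V)]
    rcases V.eq_empty_or_nonempty with rfl | hV
    · simp [neighbors]
    have hVpos := hV.card_pos
    have hsub : (A \ W) \ neighbors V ⊆ A \ W ∪ neighbors V :=
      sdiff_subset.trans subset_union_left
    rw [sum_disjointRows_eq hsub]
    refine sum_congr rfl fun U hU => ?_
    have hdiff : (A \ W ∪ neighbors V) \ ((A \ W) \ neighbors V) = neighbors V := by
      ext x
      simp only [mem_sdiff, mem_union]
      tauto
    have hdiff' : (neighbors V ∪ neighbors U) \ (neighbors V \ neighbors U) = neighbors U := by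
      ext x
      simp only [mem_sdiff, mem_union]
      tauto
    rw [hdiff, card_union_of_mem_disjointRows hU, neighbors_union,
      ih _ (sdiff_subset.trans subset_union_left : neighbors V \ neighbors U ⊆ _)
        (by push_cast at hN ⊢; omega), hdiff']
    refine sum_congr rfl fun X hX => ?_
    rw [neighbors_union, card_union_of_mem_disjointRows hX]
    congr 2
    push_cast
    ring

theorem encard_towersWithin_erase (n : ℤ) {A : Finset ℤ} {a : ℤ} (ha : a ∈ A) :
    (towersWithin A n).encard = (towersWithin (A.erase a) n).encard +
      (towersWithin (A ∪ {a - 1, a + 1}) (n - 1)).encard := by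
  have h : disjointRows {a} = {∅, {a}} := by
    ext T
    rw [mem_disjointRows, subset_singleton_iff, mem_insert, mem_singleton]
    refine ⟨And.left, fun hT => ⟨hT, ?_⟩⟩
    rcases hT with rfl | rfl <;> simp
  have hA : A \ {a} ∪ neighbors {a} = A ∪ {a - 1, a + 1} := by
    ext x
    simp only [mem_union, mem_sdiff, mem_singleton, neighbors, singleton_biUnion, mem_insert]
    by_cases hx : x = a
    · subst hx
      simp [ha]
    · simp [hx]
  rw [encard_towersWithin_eq_sum n (singleton_subset_iff.2 ha), h,
    sum_pair (singleton_ne_empty a).symm, hA]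
  simp [neighbors, sdiff_singleton_eq_erase]

theorem encard_towersWithin_Icc (m k : ℕ) (l : ℤ) :
    (towersWithin (Icc l (l + k)) m).encard = ((2 * m + k - 1).choose m : ℕ) := by
  induction m generalizing k l with
  | zero => simpa using encard_towersWithin_zero _
  | succ m ihm =>
    induction k generalizing l with
    | zero =>
      have h : Icc l (l + (0 : ℕ)) ∪ {l - 1, l + 1} = Icc (l - 1) (l - 1 + (2 : ℕ)) := by
        ext x
        simp only [mem_union, mem_Icc, mem_insert, mem_singleton]
        push_cast
        omega
      rw [encard_towersWithin_erase (a := l) _ (by simp), h]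
      have h' : (Icc l (l + (0 : ℕ))).erase l = ∅ := by simp
      rw [h', encard_towersWithin_empty (by push_cast; omega), zero_add, Nat.cast_succ m,
        add_sub_cancel_right, ihm]
      congr 1
      have := Nat.choose_symm_half m
      rw [show 2 * m + 2 - 1 = 2 * m + 1 by omega,
        show 2 * (m + 1) + 0 - 1 = 2 * m + 1 by omega]
      exact this.symm
    | succ k ihk =>
      have h : Icc l (l + (k + 1 : ℕ)) ∪ {l + (k + 1 : ℕ) - 1, l + (k + 1 : ℕ) + 1} =
          Icc l (l + (k + 2 : ℕ)) := by
        ext x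
        simp only [mem_union, mem_Icc, mem_insert, mem_singleton]
        push_cast
        omega
      have h' : (Icc l (l + (k + 1 : ℕ))).erase (l + (k + 1 : ℕ)) = Icc l (l + k) := by
        ext x
        simp only [mem_erase, mem_Icc]
        push_cast
        omega
      rw [encard_towersWithin_erase (a := l + (k + 1 : ℕ)) _ (by simp; omega), h, h', ihk,
        Nat.cast_succ m, add_sub_cancel_right, ihm, ← Nat.cast_add]
      congr 1
      rw [show 2 * (m + 1) + (k + 1) - 1 = (2 * m + k + 1) + 1 by omega,
        show 2 * (m + 1) + k - 1 = 2 * m + k + 1 by omega,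
        show 2 * m + (k + 2) - 1 = 2 * m + k + 1 by omega, Nat.choose_succ_succ (2 * m + k + 1),
        add_comm]

theorem neighbors_base {b : ℕ} (hb : 1 ≤ b) :
    neighbors ((range b).image fun t : ℕ => 2 * (t : ℤ)) = Icc (-1 : ℤ) (-1 + (2 * b : ℕ)) := by
  ext x
  simp only [mem_neighbors, mem_image, mem_range, mem_Icc]
  push_cast
  constructor
  · rintro (⟨t, h, h'⟩ | ⟨t, h, h'⟩ | ⟨t, h, h'⟩) <;> omega
  · rintro ⟨h, h'⟩
    rcases Int.even_or_odd' x with ⟨c, rfl | rfl⟩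
    · exact Or.inr (Or.inl ⟨c.toNat, by omega, by omega⟩)
    · rcases lt_or_ge c 0 with hc | hc
      · exact Or.inr (Or.inr ⟨0, by omega, by push_cast; omega⟩)
      · exact Or.inl ⟨c.toNat, by omega, by omega⟩

/-- The number of `(n,b)`-domino towers equals `C(2n-1, n-b)` for all `n ≥ b ≥ 1`. -/
theorem card_domino_towers (n b : ℕ) (hb : 1 ≤ b) (hbn : b ≤ n) :
    {D : Finset (ℤ × ℕ) | IsDominoTower n b D}.ncard = Nat.choose (2 * n - 1) (n - b) := by
  have hset : {D : Finset (ℤ × ℕ) | IsDominoTower n b D} =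
      towersOn ((range b).image fun t : ℕ => 2 * (t : ℤ)) n := by
    ext D
    simp [IsDominoTower, towersOn]
  have hcard : ((range b).image fun t : ℕ => 2 * (t : ℤ)).card = b := by
    rw [card_image_of_injective _ (fun s t h => by simpa using h), card_range]
  have hdisj : ∀ x ∈ (range b).image (fun t : ℕ => 2 * (t : ℤ)),
      x + 1 ∉ (range b).image (fun t : ℕ => 2 * (t : ℤ)) := by
    intro x hx hx'
    simp only [mem_image, mem_range] at hx hx'
    obtain ⟨s, -, hs⟩ := hx
    obtain ⟨t, -, ht⟩ := hx'
    omega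
  rw [hset, Set.ncard, encard_towersOn hdisj, hcard, neighbors_base hb, ← Nat.cast_sub hbn,
    encard_towersWithin_Icc, ENat.toNat_natCast]
  congr 1
  omega
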